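/- arXiv:1805.00235 — 2 statements merged into one kernel-verified Lean document; each statement's English description precedes it below -/
import Mathlib

section
/- For every y ∈ ℝ³, each k ∈ {1,2,3}, and every smooth compactly supported test function φ : ℝ³ → ℝ, one has ∑_{j=1}^{3} ∫_{ℝ³} ů_j^k(x,y) ∂_{x_j} φ(x) dx = 0; that is, the velocity fundamental solution ů^k(·,y) is divergence-free on all of ℝ³ in the sense of distributions. -/
open MeasureTheory Real

noncomputable section

/-- 3-dimensional Euclidean space. -/
abbrev E3 : Type := EuclideanSpace ℝ (Fin 3)

/-- The `i`-th standard basis vector of `ℝ³`. -/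
def e3 (i : Fin 3) : E3 := EuclideanSpace.single i (1 : ℝ)

/-- Pressure fundamental solution of the constant-viscosity Stokes system:
`q̊^k(x,y) = -(x_k - y_k)/(4π‖x-y‖³)`. -/
def qF (k : Fin 3) (x y : E3) : ℝ := -(x k - y k) / (4 * π * ‖x - y‖ ^ 3)

/-- Velocity fundamental solution of the constant-viscosity incompressible Stokes system:
`ů_j^k(x,y) = -(1/8π)(δ_j^k/‖x-y‖ + (x_j-y_j)(x_k-y_k)/‖x-y‖³)`. -/
def uF (j k : Fin 3) (x y : E3) : ℝ :=
  -(1 / (8 * π)) * ((if j = k then (1 : ℝ) else 0) / ‖x - y‖ +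
    (x j - y j) * (x k - y k) / ‖x - y‖ ^ 3)

/-- Partial derivative in the `i`-th coordinate direction. -/
def pd (i : Fin 3) (f : E3 → ℝ) (x : E3) : ℝ := fderiv ℝ f x (e3 i)

/-- The Laplacian `Δf = ∑ ∂²f/∂x_i²`. -/
def lap (f : E3 → ℝ) (x : E3) : ℝ := ∑ i : Fin 3, pd i (fun z => pd i f z) x

/-- Divergence of a vector field given componentwise. -/
def divg (v : Fin 3 → E3 → ℝ) (x : E3) : ℝ := ∑ l : Fin 3, pd l (v l) x

/-- Constant-viscosity (μ=1) stress tensor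
`σ̊_ij(p,v)(x) = -δ_i^j p(x) + ∂_j v_i(x) + ∂_i v_j(x) - (2/3) δ_i^j div v(x)`. -/
def sigma0 (p : E3 → ℝ) (v : Fin 3 → E3 → ℝ) (i j : Fin 3) (x : E3) : ℝ :=
  -(if i = j then p x else 0) + pd j (v i) x + pd i (v j) x
    - (2 / 3) * (if i = j then divg v x else 0)

/-- Variable-viscosity stress tensor
`σ_ij(p,v)(x) = -δ_i^j p(x) + μ(x)(∂_j v_i(x) + ∂_i v_j(x) - (2/3) δ_i^j div v(x))`. -/
def sigmaMu (μ : E3 → ℝ) (p : E3 → ℝ) (v : Fin 3 → E3 → ℝ) (i j : Fin 3) (x : E3) : ℝ :=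
  -(if i = j then p x else 0) + μ x * (pd j (v i) x + pd i (v j) x
    - (2 / 3) * (if i = j then divg v x else 0))

/-- Variable-viscosity compressible Stokes operator
`𝒜_j(p,v)(x) = ∑_i ∂_i[μ(x)(∂_i v_j + ∂_j v_i - (2/3) δ_i^j div v)] - ∂_j p(x)`. -/
def stokesA (μ : E3 → ℝ) (p : E3 → ℝ) (v : Fin 3 → E3 → ℝ) (j : Fin 3) (x : E3) : ℝ :=
  (∑ i : Fin 3, pd i (fun z => μ z * (pd i (v j) z + pd j (v i) z
      - (2 / 3) * (if i = j then divg v z else 0))) x) - pd j p x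

/-- The weakly singular remainder
`R_kj(x,y) = (3/(4πμ(y))) ∑_i ∂_iμ(x) (x_i-y_i)(x_j-y_j)(x_k-y_k)/‖x-y‖⁵`. -/
def Rrem (μ : E3 → ℝ) (k j : Fin 3) (x y : E3) : ℝ :=
  (3 / (4 * π * μ y)) * ∑ i : Fin 3, pd i μ x *
    ((x i - y i) * (x j - y j) * (x k - y k) / ‖x - y‖ ^ 5)

/-- The regularized inverse distance `(‖x - y‖² + a)^(-1/2)`. -/
def regInv (a : ℝ) (x y : E3) : ℝ := (√(‖x - y‖ ^ 2 + a))⁻¹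

/-- The divergence-free regularization of `uF` obtained by replacing `‖z‖` by `√(‖z‖² + a)` in
`uF = -(1/8π)(δ_j^k Δ - ∂_j∂_k)‖z‖`, where `z = x - y`. -/
def regU (a : ℝ) (j k : Fin 3) (x y : E3) : ℝ :=
  -(1 / (8 * π)) * ((if j = k then (1 : ℝ) else 0) * (regInv a x y + a * regInv a x y ^ 3) +
    (x j - y j) * (x k - y k) * regInv a x y ^ 3)

lemma regInv_pos {a : ℝ} (ha : 0 < a) (x y : E3) : 0 < regInv a x y := by
  unfold regInv
  positivity

lemma regInv_sq_mul {a : ℝ} (ha : 0 < a) (x y : E3) :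
    regInv a x y ^ 2 * (‖x - y‖ ^ 2 + a) = 1 := by
  have h : 0 < ‖x - y‖ ^ 2 + a := by positivity
  rw [regInv, inv_pow, Real.sq_sqrt h.le, inv_mul_cancel₀ h.ne']

lemma contDiff_regInv {a : ℝ} (ha : 0 < a) (y : E3) :
    ContDiff ℝ 1 (fun x => regInv a x y) := by
  unfold regInv
  have h : ∀ x : E3, ‖x - y‖ ^ 2 + a ≠ 0 := fun x => by positivity
  refine ContDiff.inv (ContDiff.sqrt ?_ h) fun x => (Real.sqrt_pos.2 (by positivity)).ne'
  exact ((contDiff_id.sub contDiff_const).norm_sq ℝ).add contDiff_const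

lemma contDiff_coord_sub (j : Fin 3) (y : E3) : ContDiff ℝ 1 (fun x : E3 => x j - y j) :=
  (EuclideanSpace.proj j : E3 →L[ℝ] ℝ).contDiff.sub contDiff_const

lemma contDiff_regU {a : ℝ} (ha : 0 < a) (j k : Fin 3) (y : E3) :
    ContDiff ℝ 1 (fun x => regU a j k x y) := by
  unfold regU
  have h := contDiff_regInv ha y
  have hj := contDiff_coord_sub j y
  have hk := contDiff_coord_sub k y
  fun_prop

lemma hasFDerivAt_regInv {a : ℝ} (ha : 0 < a) (x y : E3) :
    HasFDerivAt (fun x => regInv a x y) (-(regInv a x y ^ 3) • innerSL ℝ (x - y)) x := by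
  have h : 0 < ‖x - y‖ ^ 2 + a := by positivity
  have h1 : HasFDerivAt (fun x => ‖x - y‖ ^ 2 + a) _ x :=
    (((hasFDerivAt_id x).sub_const y).norm_sq).add_const a
  have h2 := (hasDerivAt_inv (Real.sqrt_pos.2 h).ne').comp_hasFDerivAt x (h1.sqrt h.ne')
  refine h2.congr_fderiv ?_
  ext v
  simp [regInv]
  field_simp

lemma hasFDerivAt_coord_sub (j : Fin 3) (x y : E3) : HasFDerivAt (fun x : E3 => x j - y j)
    (EuclideanSpace.proj j : E3 →L[ℝ] ℝ) x :=
  (EuclideanSpace.proj j : E3 →L[ℝ] ℝ).hasFDerivAt.sub_const (y j)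

lemma fderiv_regU {a : ℝ} (ha : 0 < a) (j k : Fin 3) (x y : E3) :
    fderiv ℝ (fun x => regU a j k x y) x (e3 j) =
      -(1 / (8 * π)) * ((if j = k then (1 : ℝ) else 0) *
          (-(x j - y j) * regInv a x y ^ 3 * (1 + 3 * a * regInv a x y ^ 2)) +
        ((x k - y k) + (if j = k then (1 : ℝ) else 0) * (x j - y j)) * regInv a x y ^ 3 -
        3 * (x j - y j) ^ 2 * (x k - y k) * regInv a x y ^ 5) := by
  have h := hasFDerivAt_regInv ha x y
  have hj := hasFDerivAt_coord_sub j x y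
  have hk := hasFDerivAt_coord_sub k x y
  have H := ((((h.add ((h.pow 3).const_mul a)).const_mul (if j = k then (1 : ℝ) else 0)).add
    ((hj.mul hk).mul (h.pow 3))).const_mul (-(1 / (8 * π))))
  have H' : fderiv ℝ (fun x => regU a j k x y) x = _ := H.fderiv
  rw [H']
  by_cases hjk : j = k
  · subst hjk
    simp [e3, EuclideanSpace.inner_single_right]
    ring
  · simp [e3, EuclideanSpace.inner_single_right, hjk, Ne.symm hjk]
    ring

lemma sum_fderiv_regU {a : ℝ} (ha : 0 < a) (k : Fin 3) (x y : E3) :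
    ∑ j : Fin 3, fderiv ℝ (fun x => regU a j k x y) x (e3 j) = 0 := by
  have h := regInv_sq_mul ha x y
  rw [EuclideanSpace.norm_sq_eq, Fin.sum_univ_three] at h
  simp only [PiLp.sub_apply, Real.norm_eq_abs, sq_abs] at h
  simp only [fderiv_regU ha, Fin.sum_univ_three]
  generalize regInv a x y = r at *
  fin_cases k <;> simp
  · linear_combination (3 * (1 / (8 * π)) * (x 0 - y 0) * r ^ 3) * h
  · linear_combination (3 * (1 / (8 * π)) * (x 1 - y 1) * r ^ 3) * h
  · linear_combination (3 * (1 / (8 * π)) * (x 2 - y 2) * r ^ 3) * h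

lemma sum_integral_regU {a : ℝ} (ha : 0 < a) (k : Fin 3) (y : E3) {φ : E3 → ℝ}
    (hφ : ContDiff ℝ 1 φ) (hc : HasCompactSupport φ) :
    ∑ j : Fin 3, ∫ x : E3, regU a j k x y * fderiv ℝ φ x (e3 j) = 0 := by
  have hφ' (j : Fin 3) : Continuous fun x => fderiv ℝ φ x (e3 j) :=
    (hφ.continuous_fderiv one_ne_zero).clm_apply continuous_const
  have hu' (j : Fin 3) : Continuous fun x => fderiv ℝ (fun x => regU a j k x y) x (e3 j) :=
    ((contDiff_regU ha j k y).continuous_fderiv one_ne_zero).clm_apply continuous_const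
  have hi (j : Fin 3) :
      Integrable fun x => fderiv ℝ (fun x => regU a j k x y) x (e3 j) * φ x :=
    ((hu' j).mul hφ.continuous).integrable_of_hasCompactSupport hc.mul_left
  have hparts (j : Fin 3) : ∫ x : E3, regU a j k x y * fderiv ℝ φ x (e3 j) =
      -∫ x : E3, fderiv ℝ (fun x => regU a j k x y) x (e3 j) * φ x := by
    have hu := contDiff_regU ha j k y
    exact integral_mul_fderiv_eq_neg_fderiv_mul_of_integrable (hi j)
      ((hu.continuous.mul (hφ' j)).integrable_of_hasCompactSupport
        (hc.fderiv_apply ℝ (e3 j)).mul_left)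
      ((hu.continuous.mul hφ.continuous).integrable_of_hasCompactSupport hc.mul_left)
      (fun x _ => hu.differentiable one_ne_zero x)
      (fun x _ => hφ.differentiable one_ne_zero x)
  simp_rw [hparts]
  rw [Finset.sum_neg_distrib, ← integral_finsetSum _ fun j _ => hi j]
  simp [← Finset.sum_mul, sum_fderiv_regU ha]

lemma abs_regU_le {a : ℝ} (ha : 0 < a) (j k : Fin 3) {x y : E3} (hxy : x ≠ y) :
    |regU a j k x y| ≤ 1 / (8 * π) * (3 * ‖x - y‖⁻¹) := by
  have hz : 0 < ‖x - y‖ := norm_pos_iff.2 (sub_ne_zero.2 hxy)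
  have hr := regInv_pos ha x y
  have h := regInv_sq_mul ha x y
  have hrz : regInv a x y ≤ ‖x - y‖⁻¹ :=
    inv_anti₀ hz (Real.le_sqrt_of_sq_le (by linarith))
  have hj : |x j - y j| ≤ ‖x - y‖ := PiLp.norm_apply_le (x - y) j
  have hk : |x k - y k| ≤ ‖x - y‖ := PiLp.norm_apply_le (x - y) k
  rw [regU, abs_mul, abs_neg, abs_of_pos (by positivity : 0 < 1 / (8 * π))]
  refine mul_le_mul_of_nonneg_left ?_ (by positivity)
  have hdiag : |(if j = k then (1 : ℝ) else 0) * (regInv a x y + a * regInv a x y ^ 3)| ≤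
      2 * regInv a x y := by
    have : a * regInv a x y ^ 3 ≤ regInv a x y := by
      nlinarith [mul_nonneg (sq_nonneg (regInv a x y)) (sq_nonneg ‖x - y‖)]
    rw [abs_mul, abs_of_pos (by positivity : 0 < regInv a x y + a * regInv a x y ^ 3)]
    split_ifs
    · rw [abs_one]
      linarith
    · rw [abs_zero, zero_mul]
      positivity
  have hoff : |(x j - y j) * (x k - y k) * regInv a x y ^ 3| ≤ regInv a x y := by
    rw [abs_mul, abs_mul, abs_of_pos (pow_pos hr 3)]
    have : |x j - y j| * |x k - y k| ≤ ‖x - y‖ ^ 2 := by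
      rw [sq]
      gcongr
    calc |x j - y j| * |x k - y k| * regInv a x y ^ 3
        ≤ ‖x - y‖ ^ 2 * regInv a x y ^ 3 := by gcongr
      _ ≤ regInv a x y := by nlinarith [mul_nonneg (sq_nonneg (regInv a x y)) ha.le]
  linarith [abs_add_le ((if j = k then (1 : ℝ) else 0) * (regInv a x y + a * regInv a x y ^ 3))
    ((x j - y j) * (x k - y k) * regInv a x y ^ 3)]

open Filter Topology in
lemma tendsto_regU (j k : Fin 3) {x y : E3} (hxy : x ≠ y) :
    Tendsto (fun a => regU a j k x y) (𝓝 0) (𝓝 (uF j k x y)) := by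
  have hz : 0 < ‖x - y‖ := norm_pos_iff.2 (sub_ne_zero.2 hxy)
  have hr : ContinuousAt (fun a => regInv a x y) 0 := by
    unfold regInv
    refine ContinuousAt.inv₀ (by fun_prop) ?_
    rw [add_zero]
    positivity
  have hu : ContinuousAt (fun a => regU a j k x y) 0 := by
    unfold regU
    fun_prop
  have h0 : regU 0 j k x y = uF j k x y := by
    simp [regU, uF, regInv, Real.sqrt_sq hz.le, div_eq_mul_inv]
  exact h0 ▸ hu.tendsto

lemma integrable_inv_norm_sub_mul (y : E3) {ψ : E3 → ℝ} (hψ : Continuous ψ)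
    (hc : HasCompactSupport ψ) : Integrable fun x => ‖x - y‖⁻¹ * ψ x := by
  have hloc : LocallyIntegrable (fun x : E3 => ‖x‖⁻¹) := by
    refine locallyIntegrable_of_norm_le_rpow (C := 1) (α := 1) (by simp) (by simp)
      (.of_forall fun x => ?_) measurable_norm.inv.aestronglyMeasurable
    simp [Real.rpow_neg_one]
  have h := (hloc.integrable_smul_right_of_hasCompactSupport
    (hψ.comp (continuous_add_const y))
    (hc.comp_homeomorph (Homeomorph.addRight y))).comp_sub_right y
  simpa using h

/-- For every y ∈ ℝ³, each k, and every smooth compactly supported test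
function φ, ∑_j ∫ ů_j^k(x,y) ∂_{x_j}φ(x) dx = 0: the velocity fundamental solution is
divergence-free on all of ℝ³ in the sense of distributions. -/
theorem stmt4 (y : E3) (k : Fin 3) (φ : E3 → ℝ) (hφ : ContDiff ℝ (⊤ : ℕ∞) φ)
    (hc : HasCompactSupport φ) :
    ∑ j : Fin 3, ∫ x : E3, uF j k x y * fderiv ℝ φ x (e3 j) = 0 := by
  have hφ1 : ContDiff ℝ 1 φ := hφ.of_le (by exact_mod_cast le_top)
  have hφ' (j : Fin 3) : Continuous fun x => fderiv ℝ φ x (e3 j) :=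
    (hφ1.continuous_fderiv one_ne_zero).clm_apply continuous_const
  have hne : ∀ᵐ x : E3, x ≠ y := Measure.ae_ne volume y
  have hlim (j : Fin 3) : Filter.Tendsto
      (fun n : ℕ => ∫ x : E3, regU (1 / ((n : ℝ) + 1)) j k x y * fderiv ℝ φ x (e3 j))
      Filter.atTop (nhds (∫ x : E3, uF j k x y * fderiv ℝ φ x (e3 j))) := by
    refine tendsto_integral_of_dominated_convergence
      (fun x => 1 / (8 * π) * 3 * |‖x - y‖⁻¹ * fderiv ℝ φ x (e3 j)|) (fun n => ?_)
      ((integrable_inv_norm_sub_mul y (hφ' j) (hc.fderiv_apply ℝ (e3 j))).abs.const_mul _)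
      (fun n => ?_) ?_
    · exact ((contDiff_regU Nat.one_div_pos_of_nat j k y).continuous.mul
        (hφ' j)).aestronglyMeasurable
    · filter_upwards [hne] with x hx
      rw [Real.norm_eq_abs, abs_mul, abs_mul, abs_inv, abs_norm, ← mul_assoc, mul_assoc (1 / _)]
      gcongr
      exact abs_regU_le Nat.one_div_pos_of_nat j k hx
    · filter_upwards [hne] with x hx
      exact ((tendsto_regU j k hx).comp tendsto_one_div_add_atTop_nhds_zero_nat).mul_const _
  refine tendsto_nhds_unique (tendsto_finsetSum _ fun j _ => hlim j) ?_
  simp [-one_div, sum_integral_regU Nat.one_div_pos_of_nat k y hφ1 hc]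
end
end

section
/- For every ρ ∈ C_c^∞(ℝ³,ℝ³), define the Newtonian velocity potential (𝒰̊ρ)_k(y) = ∑_{j=1}^3 ∫_{ℝ³} ů_j^k(x,y) ρ_j(x) dx and the scalar pressure potential (Q̊ρ)(y) = ∑_{j=1}^3 ∫_{ℝ³} q̊^j(y,x) ρ_j(x) dx. Then 𝒰̊ρ and Q̊ρ are smooth, div(𝒰̊ρ) = 0 on ℝ³, and the pair (Q̊ρ, 𝒰̊ρ) satisfies the inhomogeneous constant-viscosity Stokes system Å_k(Q̊ρ, 𝒰̊ρ)(y) = Δ(𝒰̊ρ)_k(y) − ∂_k (Q̊ρ)(y) = ρ_k(y) for all y ∈ ℝ³ and each k ∈ {1,2,3}. -/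
open MeasureTheory Real

noncomputable section

open Filter Topology Convolution

/-- Smooth compactly supported scalar functions on `ℝ³`. -/
def IsTest (φ : E3 → ℝ) : Prop := ContDiff ℝ (⊤ : ℕ∞) φ ∧ HasCompactSupport φ

lemma IsTest.pd {φ : E3 → ℝ} (h : IsTest φ) (i : Fin 3) : IsTest (pd i φ) :=
  ⟨(h.1.fderiv_right (m := (⊤ : ℕ∞)) (by simp)).clm_apply contDiff_const,
    h.2.fderiv_apply ℝ (e3 i)⟩

lemma IsTest.differentiable {φ : E3 → ℝ} (h : IsTest φ) : Differentiable ℝ φ :=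
  h.1.differentiable (by simp)

lemma IsTest.comp_sub_left {φ : E3 → ℝ} (h : IsTest φ) (y : E3) :
    IsTest (fun t => φ (y - t)) :=
  ⟨h.1.comp (contDiff_const.sub contDiff_id),
    h.2.comp_homeomorph (Homeomorph.subLeft y)⟩

lemma pd_comp_sub_left {φ : E3 → ℝ} (h : IsTest φ) (y : E3) (i : Fin 3) :
    pd i (fun t => φ (y - t)) = fun t => -pd i φ (y - t) := by
  funext t
  have h1 : HasFDerivAt (fun t => φ (y - t))
      ((fderiv ℝ φ (y - t)).comp (-ContinuousLinearMap.id ℝ E3)) t :=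
    (h.differentiable (y - t)).hasFDerivAt.comp t ((hasFDerivAt_id t).const_sub y)
  simp [pd, h1.fderiv]

lemma pd_pd_comp_sub_left {φ : E3 → ℝ} (h : IsTest φ) (y : E3) (i j : Fin 3) :
    pd i (pd j (fun t => φ (y - t))) = fun t => pd i (pd j φ) (y - t) := by
  have := pd_comp_sub_left (h.pd j) y i
  rw [pd_comp_sub_left h]
  funext t
  have h2 := congrFun this t
  simp only [pd] at h2 ⊢
  rw [fderiv_fun_neg]
  simp [h2]

lemma pd_comm {φ : E3 → ℝ} (h : IsTest φ) (i j : Fin 3) : pd i (pd j φ) = pd j (pd i φ) := by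
  funext x
  have hs : IsSymmSndFDerivAt ℝ φ x := by
    refine h.1.contDiffAt.isSymmSndFDerivAt ?_
    rw [minSmoothness_of_isRCLikeNormedField]
    exact WithTop.coe_le_coe.2 (OrderTop.le_top (2 : ℕ∞))
  have hd : DifferentiableAt ℝ (fderiv ℝ φ) x :=
    (h.1.fderiv_right (m := (⊤ : ℕ∞)) (by simp)).differentiable (by simp) x
  have key : ∀ a b : Fin 3, pd a (pd b φ) x = fderiv ℝ (fderiv ℝ φ) x (e3 a) (e3 b) := by
    intro a b
    have : HasFDerivAt (fun z => fderiv ℝ φ z (e3 b)) _ x :=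
      hd.hasFDerivAt.clm_apply (hasFDerivAt_const (e3 b) x)
    unfold pd
    rw [this.fderiv]
    simp
  rw [key, key, hs.eq]

/-- The convolution `K ⋆ φ`. -/
def pot (K φ : E3 → ℝ) (y : E3) : ℝ := ∫ t, K t * φ (y - t)

lemma contDiff_pot {K φ : E3 → ℝ} (hK : LocallyIntegrable K) (h : IsTest φ) :
    ContDiff ℝ (⊤ : ℕ∞) (pot K φ) :=
  h.2.contDiff_convolution_right (ContinuousLinearMap.mul ℝ ℝ) hK h.1

lemma pd_pot {K φ : E3 → ℝ} (hK : LocallyIntegrable K) (h : IsTest φ) (i : Fin 3) :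
    pd i (pot K φ) = pot K (pd i φ) := by
  funext y
  have h1 := h.2.hasFDerivAt_convolution_right (ContinuousLinearMap.mul ℝ ℝ) (μ := volume) hK
    (h.1.of_le (by simp)) y
  have h2 : pd i (pot K φ) y = _ := congrArg (fun A => A (e3 i)) h1.fderiv
  rw [h2, convolution_precompR_apply _ hK (h.2.fderiv ℝ) (h.1.continuous_fderiv (by simp))]
  rfl

lemma LocallyIntegrable.integrable_mul_test {K φ : E3 → ℝ} (hK : LocallyIntegrable K)
    (hφ : Continuous φ) (hc : HasCompactSupport φ) : Integrable (fun z => K z * φ z) :=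
  hK.integrable_smul_right_of_hasCompactSupport hφ hc

lemma integral_mul_pd {f φ : E3 → ℝ} (hf : ContDiff ℝ 1 f) (h : IsTest φ) (i : Fin 3) :
    ∫ z, f z * pd i φ z = -∫ z, pd i f z * φ z := by
  have hc : Continuous (pd i f) := (hf.continuous_fderiv (by simp)).clm_apply continuous_const
  exact integral_mul_fderiv_eq_neg_fderiv_mul_of_integrable
    (LocallyIntegrable.integrable_mul_test hc.locallyIntegrable h.1.continuous h.2)
    (LocallyIntegrable.integrable_mul_test hf.continuous.locallyIntegrable
      (h.pd i).1.continuous (h.pd i).2)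
    (LocallyIntegrable.integrable_mul_test hf.continuous.locallyIntegrable h.1.continuous h.2)
    (fun x _ => hf.differentiable (by simp) x) (fun x _ => h.differentiable x)

/-- Dominated convergence for a regularization `f ε` of a singular kernel `f₀`. -/
lemma tendsto_integral_mul {f : ℝ → E3 → ℝ} {f₀ G φ : E3 → ℝ} (hG : LocallyIntegrable G)
    (hf : ∀ ε > 0, Continuous (f ε)) (hb : ∀ ε > 0, ε ≤ 1 → ∀ z ≠ 0, |f ε z| ≤ G z)
    (hl : ∀ z ≠ 0, Tendsto (f · z) (𝓝[>] 0) (𝓝 (f₀ z)))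
    (hφ : Continuous φ) (hc : HasCompactSupport φ) :
    Tendsto (fun ε => ∫ z, f ε z * φ z) (𝓝[>] 0) (𝓝 (∫ z, f₀ z * φ z)) := by
  have hne : ∀ᵐ z : E3, z ≠ 0 := by simp [ae_iff]
  refine tendsto_integral_filter_of_dominated_convergence (fun z => G z * |φ z|) ?_ ?_ ?_ ?_
  · filter_upwards [self_mem_nhdsWithin] with ε hε
    exact ((hf ε hε).mul hφ).aestronglyMeasurable
  · filter_upwards [self_mem_nhdsWithin, mem_nhdsWithin_of_mem_nhds (Iic_mem_nhds one_pos)]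
      with ε hε hε1
    filter_upwards [hne] with z hz
    rw [norm_mul, Real.norm_eq_abs, Real.norm_eq_abs]
    exact mul_le_mul_of_nonneg_right (hb ε hε hε1 z hz) (abs_nonneg _)
  · exact LocallyIntegrable.integrable_mul_test hG hφ.abs hc.norm
  · filter_upwards [hne] with z hz
    exact (hl z hz).mul_const _

/-- Weak derivatives of a singular kernel, obtained from a regularization. -/
lemma integral_mul_pd_of_regularization {f g : ℝ → E3 → ℝ} {f₀ g₀ F G φ : E3 → ℝ} {i : Fin 3}
    (hF : LocallyIntegrable F) (hG : LocallyIntegrable G) (hf : ∀ ε > 0, ContDiff ℝ 1 (f ε))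
    (hg : ∀ ε > 0, pd i (f ε) = g ε)
    (hbf : ∀ ε > 0, ε ≤ 1 → ∀ z ≠ 0, |f ε z| ≤ F z)
    (hbg : ∀ ε > 0, ε ≤ 1 → ∀ z ≠ 0, |g ε z| ≤ G z)
    (hlf : ∀ z ≠ 0, Tendsto (f · z) (𝓝[>] 0) (𝓝 (f₀ z)))
    (hlg : ∀ z ≠ 0, Tendsto (g · z) (𝓝[>] 0) (𝓝 (g₀ z))) (h : IsTest φ) :
    ∫ z, f₀ z * pd i φ z = -∫ z, g₀ z * φ z := by
  have hgc : ∀ ε > 0, Continuous (g ε) := fun ε hε => by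
    rw [← hg ε hε]
    exact ((hf ε hε).continuous_fderiv (by simp)).clm_apply continuous_const
  have h1 := tendsto_integral_mul hF (fun ε hε => (hf ε hε).continuous) hbf hlf
    (h.pd i).1.continuous (h.pd i).2
  have h2 := (tendsto_integral_mul hG hgc hbg hlg h.1.continuous h.2).neg
  refine tendsto_nhds_unique h1 (h2.congr' ?_)
  filter_upwards [self_mem_nhdsWithin] with ε hε
  rw [integral_mul_pd (hf ε hε) h i, hg ε hε]

/-- The regularized norm `√(‖z‖² + ε²)`. -/
def regNorm (ε : ℝ) (z : E3) : ℝ := √(‖z‖ ^ 2 + ε ^ 2)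

lemma regNorm_pos {ε : ℝ} (hε : 0 < ε) (z : E3) : 0 < regNorm ε z :=
  Real.sqrt_pos.2 (by positivity)

lemma regNorm_sq (ε : ℝ) (z : E3) : regNorm ε z ^ 2 = ‖z‖ ^ 2 + ε ^ 2 :=
  Real.sq_sqrt (by positivity)

lemma norm_le_regNorm (ε : ℝ) (z : E3) : ‖z‖ ≤ regNorm ε z :=
  Real.le_sqrt_of_sq_le (by nlinarith [sq_nonneg ε])

lemma regNorm_le {ε : ℝ} (hε : 0 < ε) (h1 : ε ≤ 1) (z : E3) : regNorm ε z ≤ ‖z‖ + 1 :=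
  Real.sqrt_le_iff.2 ⟨by positivity, by nlinarith [norm_nonneg z]⟩

lemma abs_coord_le (z : E3) (i : Fin 3) : |z i| ≤ ‖z‖ := PiLp.norm_apply_le z i

lemma tendsto_regNorm (z : E3) : Tendsto (regNorm · z) (𝓝[>] 0) (𝓝 ‖z‖) := by
  have hc : Continuous (regNorm · z) := by unfold regNorm; fun_prop
  have := hc.tendsto 0
  simp only [regNorm, ne_eq, OfNat.ofNat_ne_zero, not_false_eq_true, zero_pow, add_zero,
    norm_nonneg, Real.sqrt_sq] at this
  exact this.mono_left nhdsWithin_le_nhds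

lemma contDiff_regNorm {ε : ℝ} (hε : 0 < ε) : ContDiff ℝ 1 (regNorm ε) :=
  ((contDiff_norm_sq ℝ).add contDiff_const).sqrt fun z => by positivity

lemma hasFDerivAt_regNorm {ε : ℝ} (hε : 0 < ε) (z : E3) :
    HasFDerivAt (regNorm ε) ((regNorm ε z)⁻¹ • innerSL ℝ z) z := by
  have h1 : HasFDerivAt (fun z : E3 => ‖z‖ ^ 2 + ε ^ 2) (2 • innerSL ℝ z) z :=
    (hasStrictFDerivAt_norm_sq z).hasFDerivAt.add_const _
  refine (h1.sqrt (by positivity)).congr_fderiv ?_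
  ext v
  simp [regNorm]
  ring

lemma innerSL_e3 (z : E3) (i : Fin 3) : innerSL ℝ z (e3 i) = z i := by
  simp [e3, EuclideanSpace.inner_single_right]

lemma pd_regNorm {ε : ℝ} (hε : 0 < ε) (i : Fin 3) :
    pd i (regNorm ε) = fun z => z i * (regNorm ε z)⁻¹ := by
  funext z
  unfold pd
  rw [(hasFDerivAt_regNorm hε z).fderiv]
  simp only [smul_apply, innerSL_e3, smul_eq_mul]
  ring

lemma hasFDerivAt_regNorm_inv_pow {ε : ℝ} (hε : 0 < ε) (n : ℕ) (z : E3) :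
    HasFDerivAt (fun z => (regNorm ε z)⁻¹ ^ n)
      ((-(n : ℝ) * (regNorm ε z)⁻¹ ^ (n + 2)) • innerSL ℝ z) z := by
  have hp := (regNorm_pos hε z).ne'
  have h1 := ((hasDerivAt_inv hp).fun_pow n).comp_hasFDerivAt z (hasFDerivAt_regNorm hε z)
  refine h1.congr_fderiv ?_
  rw [smul_smul]
  congr 1
  rcases n with _ | n
  · simp
  · simp only [Nat.add_sub_cancel, pow_succ]
    push_cast
    field_simp

lemma contDiff_regNorm_inv_pow {ε : ℝ} (hε : 0 < ε) (n : ℕ) :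
    ContDiff ℝ 1 (fun z => (regNorm ε z)⁻¹ ^ n) :=
  ((contDiff_regNorm hε).inv fun z => (regNorm_pos hε z).ne').pow n

lemma pd_regNorm_inv_pow {ε : ℝ} (hε : 0 < ε) (n : ℕ) (i : Fin 3) :
    pd i (fun z => (regNorm ε z)⁻¹ ^ n) = fun z => -n * (z i * (regNorm ε z)⁻¹ ^ (n + 2)) := by
  funext z
  unfold pd
  rw [(hasFDerivAt_regNorm_inv_pow hε n z).fderiv]
  simp only [smul_apply, innerSL_e3, smul_eq_mul]
  ring

lemma contDiff_coord (j : Fin 3) : ContDiff ℝ 1 (fun z : E3 => z j) :=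
  (EuclideanSpace.proj (𝕜 := ℝ) j).contDiff

lemma pd_coord_mul_regNorm_inv_pow {ε : ℝ} (hε : 0 < ε) (n : ℕ) (i j : Fin 3) :
    pd i (fun z => z j * (regNorm ε z)⁻¹ ^ n) = fun z =>
      (if j = i then 1 else 0) * (regNorm ε z)⁻¹ ^ n
        - n * (z j * z i * (regNorm ε z)⁻¹ ^ (n + 2)) := by
  funext z
  have h1 : HasFDerivAt (fun z : E3 => z j) (EuclideanSpace.proj (𝕜 := ℝ) j : E3 →L[ℝ] ℝ) z :=
    (EuclideanSpace.proj (𝕜 := ℝ) j).hasFDerivAt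
  unfold pd
  rw [(h1.fun_mul (hasFDerivAt_regNorm_inv_pow hε n z)).fderiv]
  simp only [add_apply, smul_apply, innerSL_e3,
    smul_eq_mul]
  have : (EuclideanSpace.proj (𝕜 := ℝ) j : E3 →L[ℝ] ℝ) (e3 i) = if j = i then 1 else 0 := by
    simp [e3]
  rw [this]
  ring

lemma aestronglyMeasurable_of_continuousAt_ne {f : E3 → ℝ}
    (hf : ∀ z ≠ 0, ContinuousAt f z) : AEStronglyMeasurable f := by
  have h : AEStronglyMeasurable f (volume.restrict {(0 : E3)}ᶜ) :=
    (show ContinuousOn f {(0 : E3)}ᶜ from fun z hz =>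
      (hf z hz).continuousWithinAt).aestronglyMeasurable (measurableSet_singleton _).compl
  rwa [restrict_compl_singleton] at h

lemma locallyIntegrable_norm_inv_pow (n : ℕ) (hn : n ≤ 2) :
    LocallyIntegrable (fun z : E3 => ‖z‖⁻¹ ^ n) := by
  refine locallyIntegrable_of_norm_le_rpow (C := 1) (α := n) (by simp) ?_ ?_ ?_
  · have : (n : ℝ) ≤ 2 := by exact_mod_cast hn
    simp only [finrank_euclideanSpace, Fintype.card_fin]
    push_cast
    linarith
  · refine Eventually.of_forall fun z => ?_
    rw [Real.rpow_neg (norm_nonneg _), Real.rpow_natCast]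
    simp
  · refine aestronglyMeasurable_of_continuousAt_ne fun z hz => ?_
    exact (continuous_norm.continuousAt.inv₀ (norm_ne_zero_iff.2 hz)).pow n

lemma locallyIntegrable_norm_inv : LocallyIntegrable (fun z : E3 => ‖z‖⁻¹) := by
  simpa using locallyIntegrable_norm_inv_pow 1 (by norm_num)

lemma LocallyIntegrable.of_abs_le {f G : E3 → ℝ} (hG : LocallyIntegrable G)
    (hf : ∀ z ≠ 0, ContinuousAt f z) (hb : ∀ z ≠ 0, |f z| ≤ G z) : LocallyIntegrable f := by
  refine hG.mono (aestronglyMeasurable_of_continuousAt_ne hf) ?_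
  have hne : ∀ᵐ z : E3, z ≠ 0 := by simp [ae_iff]
  filter_upwards [hne] with z hz
  exact (hb z hz).trans (le_abs_self _)

lemma continuousAt_norm_inv_pow (n : ℕ) {z : E3} (hz : z ≠ 0) :
    ContinuousAt (fun z : E3 => ‖z‖⁻¹ ^ n) z :=
  (continuous_norm.continuousAt.inv₀ (norm_ne_zero_iff.2 hz)).pow n

lemma tendsto_regNorm_inv_pow (n : ℕ) {z : E3} (hz : z ≠ 0) :
    Tendsto (fun ε => (regNorm ε z)⁻¹ ^ n) (𝓝[>] 0) (𝓝 (‖z‖⁻¹ ^ n)) :=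
  ((tendsto_regNorm z).inv₀ (norm_ne_zero_iff.2 hz)).pow n

lemma regNorm_inv_le (ε : ℝ) {z : E3} (hz : z ≠ 0) : (regNorm ε z)⁻¹ ≤ ‖z‖⁻¹ :=
  inv_anti₀ (norm_pos_iff.2 hz) (norm_le_regNorm ε z)

lemma abs_coord_mul_inv_pow_le {z : E3} {S : ℝ} (hz : z ≠ 0) (hS : ‖z‖ ≤ S) (i : Fin 3) (n : ℕ) :
    |z i * S⁻¹ ^ (n + 1)| ≤ ‖z‖⁻¹ ^ n := by
  have hz' := norm_pos_iff.2 hz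
  have hS' := hz'.trans_le hS
  rw [abs_mul, abs_of_nonneg (by positivity : 0 ≤ S⁻¹ ^ (n + 1)), pow_succ']
  calc |z i| * (S⁻¹ * S⁻¹ ^ n) ≤ S * (S⁻¹ * S⁻¹ ^ n) := by
        gcongr
        exact (abs_coord_le z i).trans hS
    _ = S⁻¹ ^ n := by field_simp
    _ ≤ ‖z‖⁻¹ ^ n := by gcongr

lemma abs_coord_mul_coord_mul_inv_pow_le {z : E3} {S : ℝ} (hz : z ≠ 0) (hS : ‖z‖ ≤ S)
    (i j : Fin 3) (n : ℕ) : |z i * z j * S⁻¹ ^ (n + 2)| ≤ ‖z‖⁻¹ ^ n := by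
  have hz' := norm_pos_iff.2 hz
  have hS' := hz'.trans_le hS
  rw [abs_mul, abs_mul, abs_of_nonneg (by positivity : 0 ≤ S⁻¹ ^ (n + 2))]
  calc |z i| * |z j| * S⁻¹ ^ (n + 2) ≤ S * S * S⁻¹ ^ (n + 2) := by
        gcongr
        · exact (abs_coord_le z i).trans hS
        · exact (abs_coord_le z j).trans hS
    _ = S⁻¹ ^ n := by rw [pow_add]; field_simp
    _ ≤ ‖z‖⁻¹ ^ n := by gcongr

lemma locallyIntegrable_coord_mul {n : ℕ} (hn : n ≤ 2) (i : Fin 3) :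
    LocallyIntegrable (fun z : E3 => z i * ‖z‖⁻¹ ^ (n + 1)) :=
  LocallyIntegrable.of_abs_le (locallyIntegrable_norm_inv_pow n hn)
    (fun _ hz => (contDiff_coord i).continuous.continuousAt.mul (continuousAt_norm_inv_pow _ hz))
    (fun _ hz => abs_coord_mul_inv_pow_le hz le_rfl i n)

lemma locallyIntegrable_coord_mul_coord_mul {n : ℕ} (hn : n ≤ 2) (i j : Fin 3) :
    LocallyIntegrable (fun z : E3 => z i * z j * ‖z‖⁻¹ ^ (n + 2)) :=
  LocallyIntegrable.of_abs_le (locallyIntegrable_norm_inv_pow n hn)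
    (fun _ hz => ((contDiff_coord i).continuous.mul (contDiff_coord j).continuous).continuousAt.mul
      (continuousAt_norm_inv_pow _ hz))
    (fun _ hz => abs_coord_mul_coord_mul_inv_pow_le hz le_rfl i j n)

lemma integral_norm_mul_pd {φ : E3 → ℝ} (h : IsTest φ) (i : Fin 3) :
    ∫ z, ‖z‖ * pd i φ z = -∫ z, z i * ‖z‖⁻¹ * φ z := by
  refine integral_mul_pd_of_regularization (f := regNorm)
    (g := fun ε z => z i * (regNorm ε z)⁻¹) (F := fun z => ‖z‖ + 1) (G := fun _ => 1)
    (by fun_prop : Continuous fun z : E3 => ‖z‖ + 1).locallyIntegrable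
    continuous_const.locallyIntegrable
    (fun ε hε => contDiff_regNorm hε) (fun ε hε => pd_regNorm hε i) ?_ ?_
    (fun z _ => tendsto_regNorm z) ?_ h
  · intro ε hε h1 z _
    rw [abs_of_pos (regNorm_pos hε z)]
    exact regNorm_le hε h1 z
  · intro ε _ _ z hz
    simpa using abs_coord_mul_inv_pow_le hz (norm_le_regNorm ε z) i 0
  · intro z hz
    simpa using (tendsto_regNorm_inv_pow 1 hz).const_mul (z i)

lemma integral_norm_inv_mul_pd {φ : E3 → ℝ} (h : IsTest φ) (i : Fin 3) :
    ∫ z, ‖z‖⁻¹ * pd i φ z = ∫ z, z i * ‖z‖⁻¹ ^ 3 * φ z := by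
  have key := integral_mul_pd_of_regularization (f := fun ε z => (regNorm ε z)⁻¹ ^ 1)
    (g := fun ε z => -(1 : ℕ) * (z i * (regNorm ε z)⁻¹ ^ (1 + 2)))
    (f₀ := fun z => ‖z‖⁻¹ ^ 1) (g₀ := fun z => -(1 : ℕ) * (z i * ‖z‖⁻¹ ^ (1 + 2)))
    (locallyIntegrable_norm_inv_pow 1 (by norm_num)) (locallyIntegrable_norm_inv_pow 2 le_rfl)
    (fun ε hε => contDiff_regNorm_inv_pow hε 1) (fun ε hε => pd_regNorm_inv_pow hε 1 i) ?_ ?_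
    (fun z hz => tendsto_regNorm_inv_pow 1 hz) ?_ h
  · simpa [integral_neg] using key
  · intro ε hε _ z hz
    have := regNorm_pos hε z
    simpa [abs_of_pos this] using regNorm_inv_le ε hz
  · intro ε _ _ z hz
    simpa using abs_coord_mul_inv_pow_le hz (norm_le_regNorm ε z) i 2
  · intro z hz
    exact ((tendsto_regNorm_inv_pow 3 hz).const_mul (z i)).const_mul _

lemma integral_coord_mul_norm_inv_mul_pd {φ : E3 → ℝ} (h : IsTest φ) (i j : Fin 3) :
    ∫ z, z j * ‖z‖⁻¹ * pd i φ z =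
      (∫ z, z j * z i * ‖z‖⁻¹ ^ 3 * φ z) - (if j = i then 1 else 0) * ∫ z, ‖z‖⁻¹ * φ z := by
  have key := integral_mul_pd_of_regularization (f := fun ε z => z j * (regNorm ε z)⁻¹ ^ 1)
    (g := fun ε z => (if j = i then 1 else 0) * (regNorm ε z)⁻¹ ^ 1
        - (1 : ℕ) * (z j * z i * (regNorm ε z)⁻¹ ^ (1 + 2)))
    (f₀ := fun z => z j * ‖z‖⁻¹ ^ 1)
    (g₀ := fun z => (if j = i then 1 else 0) * ‖z‖⁻¹ ^ 1
        - (1 : ℕ) * (z j * z i * ‖z‖⁻¹ ^ (1 + 2)))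
    (F := fun _ => 1) (G := fun z => ‖z‖⁻¹ + ‖z‖⁻¹)
    continuous_const.locallyIntegrable (locallyIntegrable_norm_inv.add locallyIntegrable_norm_inv)
    (fun ε hε => (contDiff_coord j).mul (contDiff_regNorm_inv_pow hε 1))
    (fun ε hε => pd_coord_mul_regNorm_inv_pow hε 1 i j) ?_ ?_ ?_ ?_ h
  · have e1 : ∀ z : E3, ((if j = i then 1 else 0) * ‖z‖⁻¹ ^ 1
        - (1 : ℕ) * (z j * z i * ‖z‖⁻¹ ^ (1 + 2))) * φ z
        = (if j = i then 1 else 0) * (‖z‖⁻¹ * φ z) - z j * z i * ‖z‖⁻¹ ^ 3 * φ z := by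
      intro z
      push_cast
      ring
    simp only [e1] at key
    simp only [pow_one] at key
    rw [key, integral_sub, integral_const_mul]
    · ring
    · exact (LocallyIntegrable.integrable_mul_test locallyIntegrable_norm_inv
        h.1.continuous h.2).const_mul _
    · exact LocallyIntegrable.integrable_mul_test
        (locallyIntegrable_coord_mul_coord_mul (n := 1) (by norm_num) j i) h.1.continuous h.2
  · intro ε _ _ z hz
    simpa using abs_coord_mul_inv_pow_le hz (norm_le_regNorm ε z) j 0
  · intro ε hε _ z hz
    refine (abs_sub _ _).trans (add_le_add ?_ ?_)
    · have := regNorm_pos hε z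
      have h2 := regNorm_inv_le ε hz
      split_ifs
      · simpa [abs_of_pos this] using h2
      · simp
    · simpa using abs_coord_mul_coord_mul_inv_pow_le hz (norm_le_regNorm ε z) j i 1
  · intro z hz
    exact (tendsto_regNorm_inv_pow 1 hz).const_mul _
  · intro z hz
    exact ((tendsto_regNorm_inv_pow 1 hz).const_mul _).sub
      (((tendsto_regNorm_inv_pow 3 hz).const_mul _).const_mul _)

lemma integral_Ioi_sq_mul_inv_sqrt_pow :
    ∫ r in Set.Ioi (0 : ℝ), r ^ 2 * (√(r ^ 2 + 1))⁻¹ ^ 5 = 1 / 3 := by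
  have hd : ∀ r ∈ Set.Ici (0 : ℝ), HasDerivAt (fun r : ℝ => (r * (√(r ^ 2 + 1))⁻¹) ^ 3 / 3)
      (r ^ 2 * (√(r ^ 2 + 1))⁻¹ ^ 5) r := by
    intro r _
    have hp : 0 < √(r ^ 2 + 1) := Real.sqrt_pos.2 (by positivity)
    have hs : √(r ^ 2 + 1) ^ 2 = r ^ 2 + 1 := Real.sq_sqrt (by positivity)
    have h1 : HasDerivAt (fun r : ℝ => √(r ^ 2 + 1)) _ r :=
      (((hasDerivAt_id r).fun_pow 2).add_const 1).sqrt (by simp; positivity)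
    refine ((((hasDerivAt_id r).mul (h1.inv hp.ne')).pow 3).div_const 3).congr_deriv ?_
    simp only [id, Pi.mul_apply, Pi.inv_apply, Nat.add_one_sub_one]
    generalize √(r ^ 2 + 1) = S at hp hs
    field_simp
    push_cast
    linear_combination (6 * r ^ 2 : ℝ) * hs
  have hl : Tendsto (fun r : ℝ => (r * (√(r ^ 2 + 1))⁻¹) ^ 3 / 3) atTop (𝓝 (1 / 3)) := by
    have h1 : Tendsto (fun r : ℝ => ((√(1 + r⁻¹ ^ 2))⁻¹) ^ 3 / 3) atTop
        (𝓝 (((√(1 + 0 ^ 2))⁻¹) ^ 3 / 3)) := by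
      have h2 : Tendsto (fun r : ℝ => √(1 + r⁻¹ ^ 2)) atTop (𝓝 √(1 + 0 ^ 2)) :=
        ((tendsto_inv_atTop_zero.pow 2).const_add 1).sqrt
      exact ((h2.inv₀ (by simp)).pow 3).div_const 3
    simp only [ne_eq, OfNat.ofNat_ne_zero, not_false_eq_true, zero_pow, add_zero, Real.sqrt_one,
      inv_one, one_pow] at h1
    refine h1.congr' ?_
    filter_upwards [eventually_gt_atTop 0] with r hr
    have e : √(r ^ 2 + 1) = r * √(1 + r⁻¹ ^ 2) := by
      rw [← Real.sqrt_sq hr.le, ← Real.sqrt_mul (by positivity), Real.sqrt_sq hr.le]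
      congr 1
      field_simp
    rw [e]
    field_simp
  have hi := integrableOn_Ioi_deriv_of_nonneg' hd (fun r _ => by positivity) hl
  simpa using integral_Ioi_of_hasDerivAt_of_tendsto' hd hi hl

lemma integral_regNorm_one_inv_pow :
    ∫ z : E3, 3 / (4 * π) * (regNorm 1 z)⁻¹ ^ 5 = 1 := by
  have h := integral_fun_norm_addHaar (volume : Measure E3) (fun r => (√(r ^ 2 + 1))⁻¹ ^ 5)
  have hv : (volume : Measure E3).real (Metric.ball 0 1) = π * 4 / 3 := by
    rw [Measure.real, EuclideanSpace.volume_ball_fin_three]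
    simp [ENNReal.toReal_ofReal (by positivity : 0 ≤ π * 4 / 3)]
  simp only [finrank_euclideanSpace, Fintype.card_fin, Nat.add_one_sub_one, smul_eq_mul, hv,
    integral_Ioi_sq_mul_inv_sqrt_pow, nsmul_eq_mul] at h
  rw [integral_const_mul]
  simp only [regNorm, one_pow]
  rw [h]
  have := Real.pi_pos.ne'
  push_cast
  field_simp

lemma regNorm_one_smul {c : ℝ} (hc : 0 < c) (z : E3) :
    regNorm 1 (c • z) = c * regNorm c⁻¹ z := by
  unfold regNorm
  rw [norm_smul, Real.norm_eq_abs, abs_of_pos hc]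
  nth_rw 2 [← Real.sqrt_sq hc.le]
  rw [← Real.sqrt_mul (by positivity)]
  congr 1
  field_simp

lemma tendsto_integral_peak {φ : E3 → ℝ} (hφ : Continuous φ) (hc : HasCompactSupport φ) :
    Tendsto (fun ε => ∫ z, 3 * ε ^ 2 * (regNorm ε z)⁻¹ ^ 5 * φ z) (𝓝[>] 0)
      (𝓝 (4 * π * φ 0)) := by
  have hdecay : Tendsto (fun z : E3 => ‖z‖ ^ Module.finrank ℝ E3 *
      (3 / (4 * π) * (regNorm 1 z)⁻¹ ^ 5)) (Bornology.cobounded E3) (𝓝 0) := by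
    have h0 : Tendsto (fun z : E3 => 3 / (4 * π) * ‖z‖⁻¹ ^ 2) (Bornology.cobounded E3)
        (𝓝 (3 / (4 * π) * 0 ^ 2)) :=
      ((tendsto_norm_cobounded_atTop.inv_tendsto_atTop).pow 2).const_mul _
    rw [zero_pow two_ne_zero, mul_zero] at h0
    refine squeeze_zero' (Eventually.of_forall fun z => ?_) ?_ h0
    · have := regNorm_pos one_pos z
      positivity
    · filter_upwards [tendsto_norm_cobounded_atTop.eventually_gt_atTop 0] with z hz
      have hS := regNorm_pos one_pos z
      have hle := regNorm_inv_le 1 (norm_pos_iff.1 hz)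
      simp only [finrank_euclideanSpace, Fintype.card_fin]
      calc ‖z‖ ^ 3 * (3 / (4 * π) * (regNorm 1 z)⁻¹ ^ 5)
          ≤ ‖z‖ ^ 3 * (3 / (4 * π) * ‖z‖⁻¹ ^ 5) := by gcongr
        _ = 3 / (4 * π) * ‖z‖⁻¹ ^ 2 := by field_simp
  have key := tendsto_integral_comp_smul_smul_of_integrable (μ := (volume : Measure E3))
    (φ := fun z => 3 / (4 * π) * (regNorm 1 z)⁻¹ ^ 5)
    (fun z => by have := regNorm_pos one_pos z; positivity)
    integral_regNorm_one_inv_pow hdecay (hφ.integrable_of_hasCompactSupport hc) hφ.continuousAt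
  refine ((key.comp tendsto_inv_nhdsGT_zero).const_mul (4 * π)).congr' ?_
  filter_upwards [self_mem_nhdsWithin] with ε (hε : 0 < ε)
  simp only [Function.comp_apply]
  rw [← integral_const_mul]
  refine integral_congr_ae (Eventually.of_forall fun z => ?_)
  have hS := regNorm_pos hε z
  simp only [regNorm_one_smul (inv_pos.2 hε), inv_inv, finrank_euclideanSpace, Fintype.card_fin,
    smul_eq_mul]
  field_simp

lemma sum_integral_coord_mul_pd {φ : E3 → ℝ} (h : IsTest φ) :
    ∑ i : Fin 3, ∫ z, z i * ‖z‖⁻¹ ^ 3 * pd i φ z = -(4 * π * φ 0) := by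
  have h1 : Tendsto (fun ε => ∑ i : Fin 3, ∫ z, z i * (regNorm ε z)⁻¹ ^ 3 * pd i φ z) (𝓝[>] 0)
      (𝓝 (∑ i : Fin 3, ∫ z, z i * ‖z‖⁻¹ ^ 3 * pd i φ z)) := by
    refine tendsto_finsetSum _ fun i _ => ?_
    refine tendsto_integral_mul (locallyIntegrable_norm_inv_pow 2 le_rfl)
      (f := fun ε z => z i * (regNorm ε z)⁻¹ ^ 3)
      (fun ε hε => ((contDiff_coord i).mul (contDiff_regNorm_inv_pow hε 3)).continuous)
      (fun ε hε _ z hz => abs_coord_mul_inv_pow_le hz (norm_le_regNorm ε z) i 2)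
      (fun z hz => (tendsto_regNorm_inv_pow 3 hz).const_mul _)
      (h.pd i).1.continuous (h.pd i).2
  refine tendsto_nhds_unique h1 ((tendsto_integral_peak h.1.continuous h.2).neg.congr' ?_)
  filter_upwards [self_mem_nhdsWithin] with ε (hε : 0 < ε)
  have hcd : ∀ i : Fin 3, ContDiff ℝ 1 (fun z : E3 => z i * (regNorm ε z)⁻¹ ^ 3) :=
    fun i => (contDiff_coord i).mul (contDiff_regNorm_inv_pow hε 3)
  simp_rw [fun i : Fin 3 => integral_mul_pd (hcd i) h i]
  rw [Finset.sum_neg_distrib, ← integral_finsetSum]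
  · congr 1
    refine integral_congr_ae (Eventually.of_forall fun z => ?_)
    have hS := regNorm_pos hε z
    have hsq := regNorm_sq ε z
    rw [EuclideanSpace.norm_sq_eq] at hsq
    simp only [Fin.sum_univ_three, Real.norm_eq_abs, sq_abs] at hsq
    simp only [pd_coord_mul_regNorm_inv_pow hε, Fin.sum_univ_three, if_true, Nat.reduceAdd]
    field_simp
    push_cast
    linear_combination (-3 * φ z) * hsq
  · intro i _
    exact LocallyIntegrable.integrable_mul_test
      (((hcd i).continuous_fderiv (by simp)).clm_apply continuous_const).locallyIntegrable
      h.1.continuous h.2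

lemma sum_pot_norm_inv_pd_pd {φ : E3 → ℝ} (h : IsTest φ) (y : E3) :
    ∑ i : Fin 3, pot (fun z => ‖z‖⁻¹) (pd i (pd i φ)) y = -(4 * π * φ y) := by
  have ht := h.comp_sub_left y
  have h1 := sum_integral_coord_mul_pd ht
  simp only [← integral_norm_inv_mul_pd (ht.pd _), sub_zero] at h1
  simpa only [pot, pd_pd_comp_sub_left h] using h1

lemma pot_coord_mul {φ : E3 → ℝ} (h : IsTest φ) (i : Fin 3) (y : E3) :
    pot (fun z => z i * ‖z‖⁻¹ ^ 3) φ y = -pot (fun z => ‖z‖⁻¹) (pd i φ) y := by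
  have h1 := integral_norm_inv_mul_pd (h.comp_sub_left y) i
  simp only [pd_comp_sub_left h, mul_neg, integral_neg] at h1
  exact h1.symm

lemma pot_coord_mul_coord_mul {φ : E3 → ℝ} (h : IsTest φ) (i j : Fin 3) (y : E3) :
    pot (fun z => z j * z i * ‖z‖⁻¹ ^ 3) φ y =
      (if j = i then 1 else 0) * pot (fun z => ‖z‖⁻¹) φ y
        - pot (fun z => ‖z‖) (pd j (pd i φ)) y := by
  have ht := h.comp_sub_left y
  have h1 := integral_norm_mul_pd (ht.pd i) j
  rw [integral_coord_mul_norm_inv_mul_pd ht i j] at h1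
  simp only [pd_pd_comp_sub_left h] at h1
  unfold pot
  rw [h1]
  ring

lemma sum_pot_norm_pd_pd {φ : E3 → ℝ} (h : IsTest φ) (y : E3) :
    ∑ i : Fin 3, pot (fun z => ‖z‖) (pd i (pd i φ)) y = 2 * pot (fun z => ‖z‖⁻¹) φ y := by
  have h1 : ∑ i : Fin 3, pot (fun z => z i * z i * ‖z‖⁻¹ ^ 3) φ y = pot (fun z => ‖z‖⁻¹) φ y := by
    unfold pot
    rw [← integral_finsetSum]
    · refine integral_congr_ae (Eventually.of_forall fun z => ?_)
      have hsq := EuclideanSpace.norm_sq_eq z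
      simp only [Fin.sum_univ_three, Real.norm_eq_abs, sq_abs] at hsq ⊢
      rcases eq_or_ne z 0 with rfl | hz
      · simp
      · have := norm_ne_zero_iff.2 hz
        field_simp
        linear_combination (-φ (y - z)) * hsq
    · intro i _
      exact LocallyIntegrable.integrable_mul_test
        (locallyIntegrable_coord_mul_coord_mul (n := 1) (by norm_num) i i)
        (h.comp_sub_left y).1.continuous (h.comp_sub_left y).2
  simp only [pot_coord_mul_coord_mul h, if_true, Fin.sum_univ_three] at h1 ⊢
  linear_combination -h1

/-- The Stokeslet as a function of `x - y`. -/
def stokeslet (j k : Fin 3) (z : E3) : ℝ :=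
  -(1 / (8 * π)) * ((if j = k then 1 else 0) * ‖z‖⁻¹ + z j * z k * ‖z‖⁻¹ ^ 3)

/-- The pressure kernel as a function of `y - x`. -/
def pressureKernel (j : Fin 3) (z : E3) : ℝ := -(1 / (4 * π)) * (z j * ‖z‖⁻¹ ^ 3)

lemma locallyIntegrable_stokeslet (j k : Fin 3) : LocallyIntegrable (stokeslet j k) :=
  ((locallyIntegrable_norm_inv.smul (if j = k then (1 : ℝ) else 0)).add
    (locallyIntegrable_coord_mul_coord_mul (n := 1) (by norm_num) j k)).smul (-(1 / (8 * π)))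

lemma locallyIntegrable_pressureKernel (j : Fin 3) : LocallyIntegrable (pressureKernel j) :=
  (locallyIntegrable_coord_mul (n := 2) le_rfl j).smul (-(1 / (4 * π)))

lemma integral_uF_mul (j k : Fin 3) (φ : E3 → ℝ) (y : E3) :
    ∫ x, uF j k x y * φ x = pot (stokeslet j k) φ y := by
  unfold pot
  rw [← integral_sub_left_eq_self _ volume y]
  refine integral_congr_ae (Eventually.of_forall fun t => ?_)
  have e : ‖y - t - y‖ = ‖t‖ := by rw [sub_sub_cancel_left, norm_neg]
  simp only [uF, stokeslet, e, PiLp.sub_apply]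
  ring

lemma integral_qF_mul (j : Fin 3) (φ : E3 → ℝ) (y : E3) :
    ∫ x, qF j y x * φ x = pot (pressureKernel j) φ y := by
  unfold pot
  rw [← integral_sub_left_eq_self _ volume y]
  refine integral_congr_ae (Eventually.of_forall fun t => ?_)
  have e : ‖y - (y - t)‖ = ‖t‖ := by rw [sub_sub_cancel]
  simp only [qF, pressureKernel, e, PiLp.sub_apply]
  field_simp
  ring

lemma pot_stokeslet {φ : E3 → ℝ} (h : IsTest φ) (j k : Fin 3) (y : E3) :
    pot (stokeslet j k) φ y = -(1 / (8 * π)) *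
      (2 * (if j = k then 1 else 0) * pot (fun z => ‖z‖⁻¹) φ y
        - pot (fun z => ‖z‖) (pd j (pd k φ)) y) := by
  have ht := h.comp_sub_left y
  have h1 : pot (stokeslet j k) φ y = -(1 / (8 * π)) *
      ((if j = k then 1 else 0) * pot (fun z => ‖z‖⁻¹) φ y
        + pot (fun z => z j * z k * ‖z‖⁻¹ ^ 3) φ y) := by
    unfold pot
    rw [← integral_const_mul, ← integral_add, ← integral_const_mul]
    · refine integral_congr_ae (Eventually.of_forall fun z => ?_)
      simp only [stokeslet]
      ring
    · exact (LocallyIntegrable.integrable_mul_test locallyIntegrable_norm_inv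
        ht.1.continuous ht.2).const_mul _
    · exact LocallyIntegrable.integrable_mul_test
        (locallyIntegrable_coord_mul_coord_mul (n := 1) (by norm_num) j k) ht.1.continuous ht.2
  rw [h1, pot_coord_mul_coord_mul h]
  ring

lemma pot_pressureKernel {φ : E3 → ℝ} (h : IsTest φ) (j : Fin 3) (y : E3) :
    pot (pressureKernel j) φ y = 1 / (4 * π) * pot (fun z => ‖z‖⁻¹) (pd j φ) y := by
  have h1 : pot (pressureKernel j) φ y = -(1 / (4 * π)) * pot (fun z => z j * ‖z‖⁻¹ ^ 3) φ y := by
    unfold pot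
    rw [← integral_const_mul]
    refine integral_congr_ae (Eventually.of_forall fun z => ?_)
    simp only [pressureKernel]
    ring
  rw [h1, pot_coord_mul h]
  ring

lemma pd_sum_pot {K φ : Fin 3 → E3 → ℝ} (hK : ∀ j, LocallyIntegrable (K j))
    (h : ∀ j, IsTest (φ j)) (i : Fin 3) :
    pd i (fun y => ∑ j : Fin 3, pot (K j) (φ j) y) =
      fun y => ∑ j : Fin 3, pot (K j) (pd i (φ j)) y := by
  funext y
  have hd : ∀ j ∈ Finset.univ, DifferentiableAt ℝ (pot (K j) (φ j)) y := fun j _ =>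
    (contDiff_pot (hK j) (h j)).differentiable (by simp) y
  simp only [← pd_pot (hK _) (h _)]
  unfold pd
  rw [fderiv_fun_sum hd]
  simp

lemma lap_sum_pot {K φ : Fin 3 → E3 → ℝ} (hK : ∀ j, LocallyIntegrable (K j))
    (h : ∀ j, IsTest (φ j)) (y : E3) :
    lap (fun y => ∑ j : Fin 3, pot (K j) (φ j) y) y =
      ∑ i : Fin 3, ∑ j : Fin 3, pot (K j) (pd i (pd i (φ j))) y := by
  refine Finset.sum_congr rfl fun i _ => ?_
  change pd i (pd i _) y = _
  rw [pd_sum_pot hK h, pd_sum_pot hK fun j => (h j).pd i]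

lemma sum_pd_stokeslet_potential {φ : Fin 3 → E3 → ℝ} (h : ∀ j, IsTest (φ j)) (y : E3) :
    ∑ k : Fin 3, pd k (fun z => ∑ j : Fin 3, pot (stokeslet j k) (φ j) z) y = 0 := by
  simp only [pd_sum_pot (fun j => locallyIntegrable_stokeslet j _) h]
  have key : ∀ j, ∑ k : Fin 3, pot (stokeslet j k) (pd k (φ j)) y = 0 := by
    intro j
    have hM := sum_pot_norm_pd_pd ((h j).pd j) y
    have hcomm : ∀ k, pd j (pd k (pd k (φ j))) = pd k (pd k (pd j (φ j))) := fun k => by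
      rw [pd_comm ((h j).pd k), pd_comm (h j) j k]
    simp only [pot_stokeslet ((h j).pd _), hcomm]
    rw [← Finset.mul_sum, Finset.sum_sub_distrib, hM]
    simp
  rw [Finset.sum_comm]
  exact Finset.sum_eq_zero fun j _ => key j

lemma lap_stokeslet_potential_sub_pd_pressure {φ : Fin 3 → E3 → ℝ} (h : ∀ j, IsTest (φ j))
    (k : Fin 3) (y : E3) :
    lap (fun z => ∑ j : Fin 3, pot (stokeslet j k) (φ j) z) y
      - pd k (fun z => ∑ j : Fin 3, pot (pressureKernel j) (φ j) z) y = φ k y := by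
  rw [lap_sum_pot (fun j => locallyIntegrable_stokeslet j k) h,
    pd_sum_pot locallyIntegrable_pressureKernel h, Finset.sum_comm, ← Finset.sum_sub_distrib]
  have key : ∀ j, (∑ i : Fin 3, pot (stokeslet j k) (pd i (pd i (φ j))) y)
      - pot (pressureKernel j) (pd k (φ j)) y = if j = k then φ j y else 0 := by
    intro j
    have hM := sum_pot_norm_pd_pd (((h j).pd k).pd j) y
    have hN := sum_pot_norm_inv_pd_pd (h j) y
    have hcomm : ∀ i, pd j (pd k (pd i (pd i (φ j)))) = pd i (pd i (pd j (pd k (φ j)))) :=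
      fun i => by
        rw [pd_comm ((h j).pd i) k i, pd_comm (h j) k i, pd_comm (((h j).pd k).pd i) j i,
          pd_comm ((h j).pd k) j i]
    simp only [pot_stokeslet (((h j).pd _).pd _), pot_pressureKernel ((h j).pd k), hcomm]
    rw [← Finset.mul_sum, Finset.sum_sub_distrib, ← Finset.mul_sum, hM, hN]
    have := Real.pi_pos.ne'
    split_ifs
    · field_simp
      ring
    · field_simp
      ring
  rw [Finset.sum_congr rfl fun j _ => key j]
  simp

lemma isTest_coord {ρ : E3 → E3} (hρ : ContDiff ℝ (⊤ : ℕ∞) ρ) (hc : HasCompactSupport ρ)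
    (j : Fin 3) : IsTest (fun x => ρ x j) :=
  ⟨(EuclideanSpace.proj (𝕜 := ℝ) j).contDiff.comp hρ,
    hc.comp_left (g := fun v : E3 => v j) (by simp)⟩

/-- For every ρ ∈ C_c^∞(ℝ³,ℝ³), the Newtonian velocity potential
(𝒰̊ρ)_k(y) = ∑_j ∫ ů_j^k(x,y) ρ_j(x) dx and the scalar pressure potential
(Q̊ρ)(y) = ∑_j ∫ q̊^j(y,x) ρ_j(x) dx are smooth, div(𝒰̊ρ) = 0 on ℝ³, and
Å_k(Q̊ρ, 𝒰̊ρ)(y) = Δ(𝒰̊ρ)_k(y) - ∂_k(Q̊ρ)(y) = ρ_k(y) for all y and k. -/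
theorem stmt14 (ρ : E3 → E3) (hρ : ContDiff ℝ (⊤ : ℕ∞) ρ) (hc : HasCompactSupport ρ) :
    (∀ k : Fin 3, ContDiff ℝ (⊤ : ℕ∞)
        (fun y : E3 => ∑ j : Fin 3, ∫ x : E3, uF j k x y * ρ x j)) ∧
    ContDiff ℝ (⊤ : ℕ∞) (fun y : E3 => ∑ j : Fin 3, ∫ x : E3, qF j y x * ρ x j) ∧
    (∀ y : E3, ∑ k : Fin 3,
        pd k (fun z : E3 => ∑ j : Fin 3, ∫ x : E3, uF j k x z * ρ x j) y = 0) ∧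
    ∀ (y : E3) (k : Fin 3),
      lap (fun z : E3 => ∑ j : Fin 3, ∫ x : E3, uF j k x z * ρ x j) y
        - pd k (fun z : E3 => ∑ j : Fin 3, ∫ x : E3, qF j z x * ρ x j) y = ρ y k := by
  have ht := isTest_coord hρ hc
  simp only [fun j k y => integral_uF_mul j k (fun x => ρ x j) y,
    fun j y => integral_qF_mul j (fun x => ρ x j) y]
  exact ⟨fun k => ContDiff.sum fun j _ => contDiff_pot (locallyIntegrable_stokeslet j k) (ht j),
    ContDiff.sum fun j _ => contDiff_pot (locallyIntegrable_pressureKernel j) (ht j),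
    sum_pd_stokeslet_potential ht,
    fun y k => lap_stokeslet_potential_sub_pd_pressure ht k y⟩
end
end
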